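/- arXiv:2501.02164 — 4 statements merged into one kernel-verified Lean document; each statement's English description precedes it below -/
import Mathlib

section
/- The functions F_1, F_2 and F_3 are constants of motion of the a_4^{(2)} Toda vector field V_1: for every differentiable solution t ↦ (x_0(t), x_1(t), x_2(t), y_0(t), y_1(t), y_2(t)) of the system ẋ_0 = x_0 y_0, ẋ_1 = x_1 y_1, ẋ_2 = x_2 y_2, ẏ_0 = 2x_0 − 2x_1, ẏ_1 = −x_0 + 2x_1 − 2x_2, ẏ_2 = −x_1 + 2x_2 whose values lie in the hyperplane H = {y_0 + 2y_1 + 2y_2 = 0}, each of the three functions t ↦ F_i(x(t), y(t)), i = 1, 2, 3, is constant. -/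
/-- `F₁ = x₀x₁²x₂²`. -/
noncomputable def todaF1 (x0 x1 x2 y0 y1 y2 : ℂ) : ℂ := x0 * x1 ^ 2 * x2 ^ 2

/-- `F₂ = y₀² + 4y₂² − 4x₀ − 8x₁ − 16x₂`. -/
noncomputable def todaF2 (x0 x1 x2 y0 y1 y2 : ℂ) : ℂ :=
  y0 ^ 2 + 4 * y2 ^ 2 - 4 * x0 - 8 * x1 - 16 * x2

/-- `F₃ = (y₀² − 4x₀)(y₂² − 4x₂) − 4x₁(y₀y₂ − 4x₂ − x₁)`. -/
noncomputable def todaF3 (x0 x1 x2 y0 y1 y2 : ℂ) : ℂ :=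
  (y0 ^ 2 - 4 * x0) * (y2 ^ 2 - 4 * x2) - 4 * x1 * (y0 * y2 - 4 * x2 - x1)

/-- `F₁`, `F₂`, `F₃` are constants of motion of the `a₄⁽²⁾` Toda
vector field `V₁`: along any differentiable solution of the Toda system lying in the
hyperplane `H = {y₀ + 2y₁ + 2y₂ = 0}`, each `t ↦ Fᵢ(x(t), y(t))` is constant. -/
theorem toda_a42_F1_F2_F3_constants_of_motion_V1
    (x0 x1 x2 y0 y1 y2 : ℝ → ℂ)
    (hx0 : ∀ t, HasDerivAt x0 (x0 t * y0 t) t)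
    (hx1 : ∀ t, HasDerivAt x1 (x1 t * y1 t) t)
    (hx2 : ∀ t, HasDerivAt x2 (x2 t * y2 t) t)
    (hy0 : ∀ t, HasDerivAt y0 (2 * x0 t - 2 * x1 t) t)
    (hy1 : ∀ t, HasDerivAt y1 (-x0 t + 2 * x1 t - 2 * x2 t) t)
    (hy2 : ∀ t, HasDerivAt y2 (-x1 t + 2 * x2 t) t)
    (hH : ∀ t, y0 t + 2 * y1 t + 2 * y2 t = 0) :
    ∀ s t : ℝ,
      todaF1 (x0 s) (x1 s) (x2 s) (y0 s) (y1 s) (y2 s) =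
        todaF1 (x0 t) (x1 t) (x2 t) (y0 t) (y1 t) (y2 t) ∧
      todaF2 (x0 s) (x1 s) (x2 s) (y0 s) (y1 s) (y2 s) =
        todaF2 (x0 t) (x1 t) (x2 t) (y0 t) (y1 t) (y2 t) ∧
      todaF3 (x0 s) (x1 s) (x2 s) (y0 s) (y1 s) (y2 s) =
        todaF3 (x0 t) (x1 t) (x2 t) (y0 t) (y1 t) (y2 t) := by
  have key : ∀ f : ℝ → ℂ, (∀ t, HasDerivAt f 0 t) → ∀ s t, f s = f t := fun f hf =>
    is_const_of_deriv_eq_zero (fun t => (hf t).differentiableAt) (fun t => (hf t).deriv)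
  intro s t
  refine ⟨?_, ?_, ?_⟩
  · refine key (fun t => todaF1 (x0 t) (x1 t) (x2 t) (y0 t) (y1 t) (y2 t)) (fun t => ?_) s t
    have h := ((hx0 t).mul ((hx1 t).pow 2)).mul ((hx2 t).pow 2)
    refine h.congr_deriv ?_
    simp only [Pi.mul_apply, Pi.pow_apply]
    push_cast
    linear_combination (x0 t * x1 t ^ 2 * x2 t ^ 2) * hH t
  · refine key (fun t => todaF2 (x0 t) (x1 t) (x2 t) (y0 t) (y1 t) (y2 t)) (fun t => ?_) s t
    have h := (((((hy0 t).pow 2).add (((hy2 t).pow 2).const_mul 4)).sub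
      ((hx0 t).const_mul 4)).sub ((hx1 t).const_mul 8)).sub ((hx2 t).const_mul 16)
    refine h.congr_deriv ?_
    push_cast
    linear_combination (-4 * x1 t) * hH t
  · refine key (fun t => todaF3 (x0 t) (x1 t) (x2 t) (y0 t) (y1 t) (y2 t)) (fun t => ?_) s t
    have h := ((((hy0 t).pow 2).sub ((hx0 t).const_mul 4)).mul
      (((hy2 t).pow 2).sub ((hx2 t).const_mul 4))).sub
      (((hx1 t).const_mul 4).mul ((((hy0 t).mul (hy2 t)).sub ((hx2 t).const_mul 4)).sub (hx1 t)))
    refine h.congr_deriv ?_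
    simp only [Pi.mul_apply, Pi.pow_apply, Pi.sub_apply]
    push_cast
    linear_combination (-2 * x1 t * (y0 t * y2 t - 4 * x2 t - 2 * x1 t)) * hH t
end

section
/- The rank of the Poisson matrix J at a point m = (x_0, x_1, x_2, y_0, y_1, y_2) ∈ ℂ^6 is determined by the vanishing of x_0, x_1, x_2: the rank of J(m) equals 0 if x_0 = x_1 = x_2 = 0; it equals 2 if exactly one of x_0, x_1, x_2 is nonzero; and it equals 4 if at least two of x_0, x_1, x_2 are nonzero. -/
open Matrix

/-- The Poisson matrix `J` of the `a₄⁽²⁾` Toda lattice, at the point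
`(x₀, x₁, x₂, y₀, y₁, y₂) ∈ ℂ⁶` (it depends only on `x₀, x₁, x₂`). -/
noncomputable def todaPoissonJ (x0 x1 x2 : ℂ) : Matrix (Fin 6) (Fin 6) ℂ :=
  (1 / 8 : ℂ) • !![0, 0, 0, 4 * x0, -2 * x0, 0;
                   0, 0, 0, -2 * x1, 2 * x1, -x1;
                   0, 0, 0, 0, -x2, x2;
                   -4 * x0, 2 * x1, 0, 0, 0, 0;
                   2 * x0, -2 * x1, x2, 0, 0, 0;
                   0, x1, -x2, 0, 0, 0]

theorem toda_rank_ge {k : ℕ} (M : Matrix (Fin 6) (Fin 6) ℂ) (f : Fin k → Fin 6)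
    (h : (M.submatrix f f).det ≠ 0) : k ≤ M.rank := by
  have h1 := Matrix.rank_of_isUnit (M.submatrix f f)
    ((Matrix.isUnit_iff_isUnit_det _).2 (isUnit_iff_ne_zero.2 h))
  have h2 := Matrix.rank_submatrix_le M f f
  simp only [Fintype.card_fin] at h1
  omega

theorem toda_rank_le {k : ℕ} (M : Matrix (Fin 6) (Fin 6) ℂ) (A : Matrix (Fin 6) (Fin k) ℂ)
    (B : Matrix (Fin k) (Fin 6) ℂ) (h : M = A * B) : M.rank ≤ k := by
  rw [h]
  exact (Matrix.rank_mul_le_left A B).trans (Matrix.rank_le_width A)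

/-- The rank of the Poisson matrix `J` at a point of `ℂ⁶` is
determined by the vanishing of `x₀, x₁, x₂`: it is `0` if all three vanish, `2` if
exactly one of them is nonzero, and `4` if at least two of them are nonzero. -/
theorem toda_a42_rank_of_J (x0 x1 x2 y0 y1 y2 : ℂ) :
    (x0 = 0 ∧ x1 = 0 ∧ x2 = 0 → (todaPoissonJ x0 x1 x2).rank = 0) ∧
    ((x0 ≠ 0 ∧ x1 = 0 ∧ x2 = 0) ∨ (x0 = 0 ∧ x1 ≠ 0 ∧ x2 = 0) ∨
        (x0 = 0 ∧ x1 = 0 ∧ x2 ≠ 0) → (todaPoissonJ x0 x1 x2).rank = 2) ∧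
    ((x0 ≠ 0 ∧ x1 ≠ 0) ∨ (x0 ≠ 0 ∧ x2 ≠ 0) ∨ (x1 ≠ 0 ∧ x2 ≠ 0) →
        (todaPoissonJ x0 x1 x2).rank = 4) := by
  refine ⟨?_, ?_, ?_⟩
  · rintro ⟨rfl, rfl, rfl⟩
    refine Nat.le_zero.1 (toda_rank_le (k := 0) _ 0 0 ?_)
    ext i j
    fin_cases i <;> fin_cases j <;> simp [todaPoissonJ]
  · rintro (⟨h, rfl, rfl⟩ | ⟨rfl, h, rfl⟩ | ⟨rfl, rfl, h⟩)
    · refine le_antisymm (toda_rank_le (k := 2) _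
        !![1, 0; 0, 0; 0, 0; 0, -(4); 0, -(-2); 0, -(0)]
        !![0, 0, 0, (4) * x0 / 8, (-2) * x0 / 8, (0) * x0 / 8; x0 / 8, 0, 0, 0, 0, 0] ?_) (toda_rank_ge (k := 2) _ ![0, 3] ?_)
      · ext i j
        fin_cases i <;> fin_cases j <;>
          simp [todaPoissonJ, Matrix.mul_apply, Fin.sum_univ_succ] <;> ring
      · rw [Matrix.det_fin_two]
        simp [todaPoissonJ, h]
    · refine le_antisymm (toda_rank_le (k := 2) _
        !![0, 0; 1, 0; 0, 0; 0, -(-2); 0, -(2); 0, -(-1)]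
        !![0, 0, 0, (-2) * x1 / 8, (2) * x1 / 8, (-1) * x1 / 8; 0, x1 / 8, 0, 0, 0, 0] ?_) (toda_rank_ge (k := 2) _ ![1, 3] ?_)
      · ext i j
        fin_cases i <;> fin_cases j <;>
          simp [todaPoissonJ, Matrix.mul_apply, Fin.sum_univ_succ] <;> ring
      · rw [Matrix.det_fin_two]
        simp [todaPoissonJ, h]
    · refine le_antisymm (toda_rank_le (k := 2) _
        !![0, 0; 0, 0; 1, 0; 0, -(0); 0, -(-1); 0, -(1)]
        !![0, 0, 0, (0) * x2 / 8, (-1) * x2 / 8, (1) * x2 / 8; 0, 0, x2 / 8, 0, 0, 0] ?_) (toda_rank_ge (k := 2) _ ![2, 4] ?_)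
      · ext i j
        fin_cases i <;> fin_cases j <;>
          simp [todaPoissonJ, Matrix.mul_apply, Fin.sum_univ_succ] <;> ring
      · rw [Matrix.det_fin_two]
        simp [todaPoissonJ, h]
  · intro h
    refine le_antisymm (toda_rank_le (k := 4) _
      !![x0 / 2, -x0 / 4, 0, 0; -x1 / 4, x1 / 4, 0, 0; 0, -x2 / 8, 0, 0;
        0, 0, 1, 0; 0, 0, 0, 1; 0, 0, -1 / 2, -1]
      !![0, 0, 0, 1, 0, -1 / 2; 0, 0, 0, 0, 1, -1;
        -x0 / 2, x1 / 4, 0, 0, 0, 0; x0 / 4, -x1 / 4, x2 / 8, 0, 0, 0] ?_) ?_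
    · ext i j
      fin_cases i <;> fin_cases j <;>
        simp [todaPoissonJ, Matrix.mul_apply, Fin.sum_univ_succ] <;> ring
    · rcases h with ⟨h, h'⟩ | ⟨h, h'⟩ | ⟨h, h'⟩
      · refine toda_rank_ge (k := 4) _ ![0, 1, 3, 4] ?_
        have e : ((todaPoissonJ x0 x1 x2).submatrix ![0, 1, 3, 4] ![0, 1, 3, 4]).det
            = (x0 * x1) ^ 2 / 256 := by
          rw [Matrix.det_succ_row_zero, Fin.sum_univ_four]
          simp only [Matrix.det_fin_three, Matrix.submatrix_apply]
          simp [todaPoissonJ, Fin.succAbove]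
          ring
        rw [e]
        exact div_ne_zero (pow_ne_zero _ (mul_ne_zero h h')) (by norm_num)
      · refine toda_rank_ge (k := 4) _ ![0, 2, 3, 4] ?_
        have e : ((todaPoissonJ x0 x1 x2).submatrix ![0, 2, 3, 4] ![0, 2, 3, 4]).det
            = (x0 * x2) ^ 2 / 256 := by
          rw [Matrix.det_succ_row_zero, Fin.sum_univ_four]
          simp only [Matrix.det_fin_three, Matrix.submatrix_apply]
          simp [todaPoissonJ, Fin.succAbove]
          ring
        rw [e]
        exact div_ne_zero (pow_ne_zero _ (mul_ne_zero h h')) (by norm_num)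
      · refine toda_rank_ge (k := 4) _ ![1, 2, 3, 4] ?_
        have e : ((todaPoissonJ x0 x1 x2).submatrix ![1, 2, 3, 4] ![1, 2, 3, 4]).det
            = (x1 * x2) ^ 2 / 1024 := by
          rw [Matrix.det_succ_row_zero, Fin.sum_univ_four]
          simp only [Matrix.det_fin_three, Matrix.submatrix_apply]
          simp [todaPoissonJ, Fin.succAbove]
          ring
        rw [e]
        exact div_ne_zero (pow_ne_zero _ (mul_ne_zero h h')) (by norm_num)
end

section
/- For every c = (c_1, c_2, c_3) in the Zariski open set Ω and every point m ∈ ℂ^6 lying on the hyperplane H = {y_0 + 2y_1 + 2y_2 = 0} and satisfying F_1(m) = c_1, F_2(m) = c_2, F_3(m) = c_3, the three gradient vectors ∇F_1(m), ∇F_2(m), ∇F_3(m) ∈ ℂ^6 are linearly independent. -/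
/-- The gradient of `F₁ = x₀x₁²x₂²`. -/
noncomputable def gradF1 (x0 x1 x2 y0 y1 y2 : ℂ) : Fin 6 → ℂ :=
  ![x1 ^ 2 * x2 ^ 2, 2 * x0 * x1 * x2 ^ 2, 2 * x0 * x1 ^ 2 * x2, 0, 0, 0]

/-- The gradient of `F₂ = y₀² + 4y₂² − 4x₀ − 8x₁ − 16x₂`. -/
noncomputable def gradF2 (x0 x1 x2 y0 y1 y2 : ℂ) : Fin 6 → ℂ :=
  ![-4, -8, -16, 2 * y0, 0, 8 * y2]

/-- The gradient of `F₃ = (y₀² − 4x₀)(y₂² − 4x₂) − 4x₁(y₀y₂ − 4x₂ − x₁)`. -/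
noncomputable def gradF3 (x0 x1 x2 y0 y1 y2 : ℂ) : Fin 6 → ℂ :=
  ![-4 * (y2 ^ 2 - 4 * x2),
    -4 * (y0 * y2 - 4 * x2 - x1) + 4 * x1,
    -4 * (y0 ^ 2 - 4 * x0) + 16 * x1,
    2 * y0 * (y2 ^ 2 - 4 * x2) - 4 * x1 * y2,
    0,
    2 * y2 * (y0 ^ 2 - 4 * x0) - 4 * x1 * y0]


/-- The discriminant vanishes when the quintic `z (4z² + c₂ z + c₃)² - 256 c₁` has the double
root `b`. -/
lemma disc_zero (c1 c2 c3 b : ℂ) (h1 : 20 * b ^ 2 + 3 * c2 * b + c3 = 0)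
    (h2 : 64 * c1 = b ^ 3 * (8 * b + c2) ^ 2) :
    256 * (3200000 * c1 ^ 2 + 2000 * c3 ^ 2 * c2 * c1 - 225 * c3 * c2 ^ 3 * c1
        + c3 ^ 5) + 1728 * c2 ^ 5 * c1 - 32 * c3 ^ 4 * c2 ^ 2 + c3 ^ 3 * c2 ^ 4 = 0 := by
  have h3 : c3 = -20 * b ^ 2 - 3 * c2 * b := by linear_combination h1
  have h4 : c1 = b ^ 3 * (8 * b + c2) ^ 2 / 64 := by linear_combination h2 / 64
  subst h3 h4
  ring

/-- Critical points with `y₀ ≠ 0`. -/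
lemma caseA (c1 c2 c3 x0 x1 x2 y0 y2 b g : ℂ) (hx0 : x0 ≠ 0) (hx1 : x1 ≠ 0) (hx2 : x2 ≠ 0)
    (hy0 : y0 ≠ 0)
    (hF1 : x0 * x1 ^ 2 * x2 ^ 2 = c1)
    (hF2 : y0 ^ 2 + 4 * y2 ^ 2 - 4 * x0 - 8 * x1 - 16 * x2 = c2)
    (hF3 : (y0 ^ 2 - 4 * x0) * (y2 ^ 2 - 4 * x2)
        - 4 * x1 * (y0 * y2 - 4 * x2 - x1) = c3)
    (e0 : g = 4 * x0 * (b + y2 ^ 2 - 4 * x2))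
    (e1 : g = 2 * x1 * (2 * b + y0 * y2 - 4 * x2 - 2 * x1))
    (e2 : g = 2 * x2 * (4 * b + y0 ^ 2 - 4 * x0 - 4 * x1))
    (e3 : (b + y2 ^ 2 - 4 * x2) * y0 = 2 * x1 * y2)
    (e5 : (4 * b + y0 ^ 2 - 4 * x0) * y2 = 2 * x1 * y0) :
    20 * b ^ 2 + 3 * c2 * b + c3 = 0 ∧ 64 * c1 = b ^ 3 * (8 * b + c2) ^ 2 := by
  have hy2 : y2 ≠ 0 := by
    rintro rfl
    have : x1 * y0 = 0 := by linear_combination -e5 / 2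
    simp_all
  obtain ⟨r, rfl⟩ : ∃ r, y2 = r * y0 := ⟨y2 / y0, by field_simp⟩
  have hr : r ≠ 0 := by rintro rfl; simp at hy2
  have hp : b + (r * y0) ^ 2 - 4 * x2 = 2 * x1 * r := by
    apply mul_right_cancel₀ hy0; linear_combination e3
  have hq : (4 * b + y0 ^ 2 - 4 * x0) * r = 2 * x1 := by
    apply mul_right_cancel₀ hy0; linear_combination e5
  have k1 : b - 4 * x2 + 4 * r ^ 2 * x0 - 4 * r ^ 2 * b = 0 := by
    linear_combination hp - r * hq
  have k2 : 2 * x0 * r ^ 2 = x2 * (1 - 2 * r) := by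
    apply mul_left_cancel₀ hx1
    linear_combination (r / 4) * (e2 - e0) - x0 * r * hp + x2 / 2 * hq
  have k3 : (1 + 2 * r) * (b * (1 - 2 * r) - 2 * x2) = 0 := by
    linear_combination k1 - 2 * k2
  have k4 : b * (1 - 2 * r) = 2 * x2 := by
    rcases mul_eq_zero.1 k3 with h | h
    · have hr' : r = -1 / 2 := by linear_combination h / 2
      subst hr'
      have : x1 * (b - x2) = 0 := by grind
      have : b - x2 = 0 := (mul_eq_zero.1 this).resolve_left hx1
      linear_combination 2 * this
    · linear_combination h
  have hg : g = b * (8 * b + c2) := by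
    apply mul_right_cancel₀ hr
    rw [← hF2]
    linear_combination r * e2 + 2 * x2 * hq - b * (hq + 4 * r * hp) - 2 * x1 * (1 - 2 * r) * k4
  have hQ : 4 * b ^ 2 + c2 * b + c3 = -2 * g := by
    have hpq : (b + (r * y0) ^ 2 - 4 * x2) * (4 * b + y0 ^ 2 - 4 * x0) = 4 * x1 ^ 2 := by
      rw [hp]; linear_combination 2 * x1 * hq
    rw [← hF2, ← hF3]
    linear_combination hpq + 2 * e1
  have hG : b * g ^ 2 = 64 * c1 := by
    have g1 : g = 8 * x0 * x1 * r := by linear_combination e0 + 4 * x0 * hp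
    have g2 : g * r = 4 * x1 * x2 * (1 - 2 * r) := by
      linear_combination r * e2 + 2 * x2 * hq
    apply mul_right_cancel₀ hr
    rw [← hF1]
    linear_combination b * g * g2 + 4 * b * x1 * x2 * (1 - 2 * r) * g1
      + 32 * x0 * x1 ^ 2 * x2 * r * k4
  exact ⟨by linear_combination hQ - 2 * hg, by
    rw [hg] at hG; linear_combination -hG⟩

/-- Critical points with `y₀ = y₂ = 0` and `x₀ ≠ 2 x₂`. -/
lemma caseB (c1 c2 c3 x0 x1 x2 b : ℂ) (hx0 : x0 ≠ 0) (hx2 : x2 ≠ 0)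
    (hne : x0 - 2 * x2 ≠ 0)
    (hF1 : x0 * x1 ^ 2 * x2 ^ 2 = c1)
    (hF2 : - 4 * x0 - 8 * x1 - 16 * x2 = c2)
    (hF3 : 16 * x0 * x2 + 16 * x1 * x2 + 4 * x1 ^ 2 = c3)
    (e1 : x0 * (b - 4 * x2) = x1 * (b - 2 * x2 - x1))
    (e2 : x0 * (b - 4 * x2) = 2 * x2 * (b - x0 - x1)) :
    20 * b ^ 2 + 3 * c2 * b + c3 = 0 ∧ 64 * c1 = b ^ 3 * (8 * b + c2) ^ 2 := by
  obtain ⟨s, hs⟩ : ∃ s, x0 - x1 = s * (x0 - 2 * x2) :=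
    ⟨(x0 - x1) / (x0 - 2 * x2), by field_simp⟩
  have hb : b = 2 * s * x2 := by
    apply mul_right_cancel₀ hne
    linear_combination e2 + 2 * x2 * hs
  subst hb
  have h1 : x1 = x0 - s * (x0 - 2 * x2) := by linear_combination -hs
  have h0 : (1 - s) ^ 2 * x0 = 2 * s * x2 := by
    apply mul_right_cancel₀ hne
    subst h1
    linear_combination e1
  have hs1 : 1 - s ≠ 0 := by
    intro h
    have hs' : s = 1 := by linear_combination -h
    subst hs'
    apply hx2
    linear_combination -h0 / 2
  have h0' : x0 = 2 * s * x2 / (1 - s) ^ 2 := by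
    field_simp; linear_combination h0
  subst h1
  rw [h0'] at hF1 hF2 hF3
  subst hF1 hF2 hF3
  constructor
  · field_simp; ring
  · field_simp; ring

/-- For every `c = (c₁, c₂, c₃)` in the Zariski open set `Ω` and
every point `m` on the hyperplane `H = {y₀ + 2y₁ + 2y₂ = 0}` with `F₁(m) = c₁`,
`F₂(m) = c₂`, `F₃(m) = c₃`, the gradients `∇F₁(m), ∇F₂(m), ∇F₃(m)` are linearly
independent. -/
theorem toda_a42_gradients_independent (c1 c2 c3 : ℂ)
    (hc1 : c1 ≠ 0)
    (hc2 : 256 * (3200000 * c1 ^ 2 + 2000 * c3 ^ 2 * c2 * c1 - 225 * c3 * c2 ^ 3 * c1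
        + c3 ^ 5) + 1728 * c2 ^ 5 * c1 - 32 * c3 ^ 4 * c2 ^ 2 + c3 ^ 3 * c2 ^ 4 ≠ 0)
    (x0 x1 x2 y0 y1 y2 : ℂ)
    (hH : y0 + 2 * y1 + 2 * y2 = 0)
    (hF1 : x0 * x1 ^ 2 * x2 ^ 2 = c1)
    (hF2 : y0 ^ 2 + 4 * y2 ^ 2 - 4 * x0 - 8 * x1 - 16 * x2 = c2)
    (hF3 : (y0 ^ 2 - 4 * x0) * (y2 ^ 2 - 4 * x2)
        - 4 * x1 * (y0 * y2 - 4 * x2 - x1) = c3) :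
    LinearIndependent ℂ
      ![gradF1 x0 x1 x2 y0 y1 y2, gradF2 x0 x1 x2 y0 y1 y2,
        gradF3 x0 x1 x2 y0 y1 y2] := by
  have hx0 : x0 ≠ 0 := by rintro rfl; simp at hF1; exact hc1 hF1.symm
  have hx1 : x1 ≠ 0 := by rintro rfl; simp at hF1; exact hc1 hF1.symm
  have hx2 : x2 ≠ 0 := by rintro rfl; simp at hF1; exact hc1 hF1.symm
  have hnode : ¬ (y0 = 0 ∧ y2 = 0 ∧ x0 = 2 * x2 ∧ x1 = 2 * x2) := by
    rintro ⟨rfl, rfl, rfl, rfl⟩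
    apply hc2
    rw [← hF1, ← hF2, ← hF3]
    ring
  rw [Fintype.linearIndependent_iff]
  intro w hw
  obtain ⟨u, hu⟩ : ∃ u, u = w 0 := ⟨_, rfl⟩
  obtain ⟨v, hv⟩ : ∃ v, v = w 1 := ⟨_, rfl⟩
  obtain ⟨t, ht⟩ : ∃ t, t = w 2 := ⟨_, rfl⟩
  have q0 := congrFun hw 0
  have q1 := congrFun hw 1
  have q2 := congrFun hw 2
  have q3 := congrFun hw 3
  have q5 := congrFun hw 5
  simp [Fin.sum_univ_three, gradF1, gradF2, gradF3, ← hu, ← hv, ← ht] at q0 q1 q2 q3 q5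
  have htz : t = 0 := by
    by_contra htn
    obtain ⟨b, rfl⟩ : ∃ b, v = t * b := ⟨v / t, by field_simp⟩
    obtain ⟨a, rfl⟩ : ∃ a, u = t * a := ⟨u / t, by field_simp⟩
    have e0 : a * c1 = 4 * x0 * (b + y2 ^ 2 - 4 * x2) := by
      apply mul_left_cancel₀ htn
      rw [← hF1]; linear_combination x0 * q0
    have e1 : a * c1 = 2 * x1 * (2 * b + y0 * y2 - 4 * x2 - 2 * x1) := by
      apply mul_left_cancel₀ htn
      rw [← hF1]; linear_combination x1 / 2 * q1
    have e2 : a * c1 = 2 * x2 * (4 * b + y0 ^ 2 - 4 * x0 - 4 * x1) := by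
      apply mul_left_cancel₀ htn
      rw [← hF1]; linear_combination x2 / 2 * q2
    have e3 : (b + y2 ^ 2 - 4 * x2) * y0 = 2 * x1 * y2 := by
      apply mul_left_cancel₀ htn
      linear_combination q3 / 2
    have e5 : (4 * b + y0 ^ 2 - 4 * x0) * y2 = 2 * x1 * y0 := by
      apply mul_left_cancel₀ htn
      linear_combination q5 / 2
    apply hc2
    by_cases hy0 : y0 = 0
    · have hy2 : y2 = 0 := by
        rw [hy0] at e3
        have : x1 * y2 = 0 := by linear_combination -e3 / 2
        exact (mul_eq_zero.1 this).resolve_left hx1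
      subst hy0 hy2
      have f1 : x0 * (b - 4 * x2) = x1 * (b - 2 * x2 - x1) := by
        linear_combination (e1 - e0) / 4
      have f2 : x0 * (b - 4 * x2) = 2 * x2 * (b - x0 - x1) := by
        linear_combination (e2 - e0) / 4
      by_cases hne : x0 - 2 * x2 = 0
      · exfalso
        have h0 : x0 = 2 * x2 := by linear_combination hne
        refine hnode ⟨rfl, rfl, h0, ?_⟩
        apply mul_left_cancel₀ hx2
        subst h0
        linear_combination f2 / 2
      · obtain ⟨g1, g2⟩ := caseB c1 c2 c3 x0 x1 x2 b hx0 hx2 hne hF1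
          (by linear_combination hF2) (by linear_combination hF3) f1 f2
        exact disc_zero c1 c2 c3 b g1 g2
    · obtain ⟨g1, g2⟩ := caseA c1 c2 c3 x0 x1 x2 y0 y2 b (a * c1) hx0 hx1 hx2 hy0 hF1 hF2 hF3
        e0 e1 e2 e3 e5
      exact disc_zero c1 c2 c3 b g1 g2
  subst htz
  have hvz : v = 0 := by
    by_contra hvn
    have z0 : y0 = 0 := by
      apply mul_left_cancel₀ hvn; linear_combination q3 / 2
    have z2 : y2 = 0 := by
      apply mul_left_cancel₀ hvn; linear_combination q5 / 8
    have a0 : u * c1 = 4 * v * x0 := by rw [← hF1]; linear_combination x0 * q0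
    have a1 : u * c1 = 4 * v * x1 := by rw [← hF1]; linear_combination x1 / 2 * q1
    have a2 : u * c1 = 4 * v * (2 * x2) := by rw [← hF1]; linear_combination x2 / 2 * q2
    refine hnode ⟨z0, z2, ?_, ?_⟩
    · apply mul_left_cancel₀ hvn; linear_combination (a2 - a0) / 4
    · apply mul_left_cancel₀ hvn; linear_combination (a2 - a1) / 4
  subst hvz
  have huz : u = 0 := by
    have : u * c1 = 0 := by rw [← hF1]; linear_combination x0 * q0
    exact (mul_eq_zero.1 this).resolve_right hc1
  intro i
  fin_cases i
  · exact hu.symm.trans huz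
  · exact hv.symm
  · exact ht.symm
end

section
/- Along any differentiable solution t ↦ (x_0, x_1, x_2, y_0, y_1, y_2)(t) of the a_4^{(2)} Toda system V_1 that lies in the hyperplane H = {y_0 + 2y_1 + 2y_2 = 0} and on which F_2 = c_2, the functions S(t) = −16 x_2(t) − c_2 and P(t) = 4 x_2(t)(−16 y_2(t)^2 + 64 x_2(t) + 16 x_1(t) + 4 c_2) + 4 c_3 satisfy dS/dt = −16 x_2 y_2 and dP/dt = −16 x_2 (−y_2 (y_0^2 − 4x_0) + 2 x_1 y_0). -/
/-- Along any differentiable solution of the `a₄⁽²⁾` Toda system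
`V₁` lying in the hyperplane `H = {y₀ + 2y₁ + 2y₂ = 0}` on which `F₂ = c₂`, the sum
`S(t) = −16x₂(t) − c₂` and product
`P(t) = 4x₂(t)(−16y₂(t)² + 64x₂(t) + 16x₁(t) + 4c₂) + 4c₃` of the roots of the
quadratic `u(λ)` satisfy `dS/dt = −16x₂y₂` and
`dP/dt = −16x₂(−y₂(y₀² − 4x₀) + 2x₁y₀)`. -/
theorem toda_a42_linearizing_sum_product (c2 c3 : ℂ)
    (x0 x1 x2 y0 y1 y2 : ℝ → ℂ)
    (hx0 : ∀ t, HasDerivAt x0 (x0 t * y0 t) t)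
    (hx1 : ∀ t, HasDerivAt x1 (x1 t * y1 t) t)
    (hx2 : ∀ t, HasDerivAt x2 (x2 t * y2 t) t)
    (hy0 : ∀ t, HasDerivAt y0 (2 * x0 t - 2 * x1 t) t)
    (hy1 : ∀ t, HasDerivAt y1 (-x0 t + 2 * x1 t - 2 * x2 t) t)
    (hy2 : ∀ t, HasDerivAt y2 (-x1 t + 2 * x2 t) t)
    (hH : ∀ t, y0 t + 2 * y1 t + 2 * y2 t = 0)
    (hF2 : ∀ t, y0 t ^ 2 + 4 * y2 t ^ 2 - 4 * x0 t - 8 * x1 t - 16 * x2 t = c2) :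
    (∀ t, HasDerivAt (fun s => -16 * x2 s - c2) (-16 * x2 t * y2 t) t) ∧
    (∀ t, HasDerivAt
      (fun s => 4 * x2 s * (-16 * y2 s ^ 2 + 64 * x2 s + 16 * x1 s + 4 * c2) + 4 * c3)
      (-16 * x2 t * (-(y2 t * (y0 t ^ 2 - 4 * x0 t)) + 2 * x1 t * y0 t)) t) := by
  refine ⟨fun t => ?_, fun t => ?_⟩
  · refine HasDerivAt.congr_deriv (((hx2 t).const_mul (-16 : ℂ)).sub_const c2) ?_
    ring
  · have h := ((((hx2 t).const_mul (4 : ℂ)).mul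
      ((((((hy2 t).pow 2).const_mul (-16 : ℂ)).add ((hx2 t).const_mul (64 : ℂ))).add
        ((hx1 t).const_mul (16 : ℂ))).add_const (4 * c2))).add_const (4 * c3))
    refine HasDerivAt.congr_deriv h ?_
    simp only [Pi.add_apply, Pi.pow_apply]
    push_cast
    linear_combination (32 * x1 t * x2 t) * hH t - 16 * x2 t * y2 t * hF2 t
end
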